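/- Let p be a prime, let A be a commutative ring with p·1 = 0, and let f : A → B be an étale ring homomorphism. Let φ_A : A → A and φ_B : B → B denote the Frobenius endomorphisms x ↦ x^p. Then the commutative square with maps φ_A : A → A, f : A → B, f : A → B, φ_B : B → B is cocartesian in commutative rings; equivalently, the ring homomorphism B ⊗_{A, φ_A} A → B sending b ⊗ a to b^p · f(a) is an isomorphism, where the tensor product is formed with A viewed as an A-algebra via φ_A. -/

import Mathlib

universe u

open TensorProduct

/-- An unramified algebra whose diagonal ideal is generated by nilpotents is an epimorphism. -/
theorem Algebra.FormallyUnramified.isEpi_of_isNilpotent {R S : Type*} [CommRing R] [CommRing S]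
    [Algebra R S] [Algebra.EssFiniteType R S] [Algebra.FormallyUnramified R S]
    (h : ∀ s : S, IsNilpotent ((1 : S) ⊗ₜ[R] s - s ⊗ₜ[R] (1 : S))) : Algebra.IsEpi R S := by
  obtain ⟨t, ht, ht1⟩ := (iff_exists_tensorProduct (R := R) (S := S)).mp inferInstance
  have hle : KaehlerDifferential.ideal R S ≤ nilradical (S ⊗[R] S) := by
    rw [← KaehlerDifferential.span_range_eq_ideal, Ideal.span_le]
    rintro _ ⟨s, rfl⟩
    exact h s
  have hmem : 1 - t ∈ KaehlerDifferential.ideal R S := by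
    simp [KaehlerDifferential.ideal, RingHom.mem_ker, ht1]
  have hunit : IsUnit t := by
    simpa using (mem_nilradical.mp (hle hmem)).isUnit_one_sub
  rw [Algebra.isEpi_iff_forall_one_tmul_eq]
  intro s
  exact sub_eq_zero.mp (hunit.mul_left_eq_zero.mp (ht s))

/-- An étale algebra in characteristic `p` through which both Frobenius endomorphisms factor
is trivial. -/
theorem Algebra.Etale.bijective_algebraMap_of_pow {p : ℕ} (hp : p.Prime) {T B : Type*}
    [CommRing T] [CommRing B] [Algebra T B] [Algebra.Etale T B] (hT : (p : T) = 0)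
    (ψ : B →+* T) (hB : ∀ b, algebraMap T B (ψ b) = b ^ p)
    (hψ : ∀ x, ψ (algebraMap T B x) = x ^ p) :
    Function.Bijective (algebraMap T B) := by
  have hflat : Module.FaithfullyFlat T B := by
    refine .of_comap_surjective fun P ↦ ⟨PrimeSpectrum.comap ψ P, ?_⟩
    ext x
    simp [hψ, P.isPrime.pow_mem_iff_mem p hp.pos]
  have hint : Algebra.IsIntegral T B :=
    ⟨fun b ↦ .of_pow hp.pos (hB b ▸ isIntegral_algebraMap)⟩
  have hfin : Module.Finite T B := Algebra.IsIntegral.finite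
  have hepi : Algebra.IsEpi T B := by
    refine Algebra.FormallyUnramified.isEpi_of_isNilpotent fun b ↦ ⟨p, ?_⟩
    rcases subsingleton_or_nontrivial (B ⊗[T] B) with _ | _
    · exact Subsingleton.elim _ _
    have : Fact p.Prime := ⟨hp⟩
    have : CharP (B ⊗[T] B) p := (CharP.charP_iff_prime_eq_zero hp).mpr <| by
      rw [← map_natCast (algebraMap T (B ⊗[T] B)), hT, map_zero]
    rw [sub_pow_char, Algebra.TensorProduct.tmul_pow, Algebra.TensorProduct.tmul_pow,
      one_pow, ← hB, Algebra.TensorProduct.tmul_one_eq_one_tmul, sub_self]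
  exact ⟨FaithfulSMul.algebraMap_injective T B,
    Algebra.isEpi_iff_surjective_algebraMap_of_finite.mp hepi⟩

/-- Relative Frobenius: the base change `A ⊗[R] S` of an étale `R`-algebra `S` along
`R → A` satisfies the universal property of `B`, provided the maps `R → A` and `S → B`
are inverse, up to `p`-th powers, to compatible maps `A → R` and `B → S`. -/
theorem Algebra.Etale.existsUnique_ringHom_of_pow {p : ℕ} (hp : p.Prime)
    {R A S B C : Type*} [CommRing R] [CommRing A] [CommRing S] [CommRing B] [CommRing C]
    [Algebra R S] [Algebra.Etale R S] [Algebra A B] [Algebra.Etale A B] [Algebra R A]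
    (hA : (p : A) = 0) (h : S →+* B) (σ : A →+* R) (τ : B →+* S)
    (hh : ∀ r, h (algebraMap R S r) = algebraMap A B (algebraMap R A r))
    (hτ : ∀ a, τ (algebraMap A B a) = algebraMap R S (σ a))
    (hσA : ∀ a, algebraMap R A (σ a) = a ^ p)
    (hhτ : ∀ b, h (τ b) = b ^ p) (hτh : ∀ s, τ (h s) = s ^ p)
    (f : S →+* C) (v : A →+* C) (hfv : ∀ r, f (algebraMap R S r) = v (algebraMap R A r)) :
    ∃! w : B →+* C, w.comp h = f ∧ w.comp (algebraMap A B) = v := by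
  algebraize [(algebraMap A B).comp (algebraMap R A), v, v.comp (algebraMap R A)]
  let hAlg : S →ₐ[R] B := { h with commutes' := hh }
  let fAlg : S →ₐ[R] C := { f with commutes' := hfv }
  let g : A ⊗[R] S →ₐ[A] B := Algebra.TensorProduct.lift (Algebra.ofId A B) hAlg fun _ _ ↦ .all _ _
  let k : A ⊗[R] S →ₐ[A] C := Algebra.TensorProduct.lift (Algebra.ofId A C) fAlg fun _ _ ↦ .all _ _
  have hg (a : A) (s : S) : g (a ⊗ₜ s) = algebraMap A B a * h s := rfl
  have hk (a : A) (s : S) : k (a ⊗ₜ s) = v a * f s := rfl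
  have hpT : (p : A ⊗[R] S) = 0 := by
    rw [← map_natCast (algebraMap A (A ⊗[R] S)), hA, map_zero]
  have hbij : Function.Bijective g := by
    let _ : Algebra (A ⊗[R] S) B := g.toRingHom.toAlgebra
    have : IsScalarTower A (A ⊗[R] S) B := .of_algebraMap_eq fun a ↦ (g.commutes a).symm
    have : Algebra.Etale (A ⊗[R] S) B := .of_restrictScalars A _ _
    let ψ : B →+* A ⊗[R] S :=
      (Algebra.TensorProduct.includeRight : S →ₐ[R] A ⊗[R] S).toRingHom.comp τ
    have hψ (b : B) : ψ b = 1 ⊗ₜ τ b := rfl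
    refine Algebra.Etale.bijective_algebraMap_of_pow hp hpT ψ (fun b ↦ ?_) fun x ↦ ?_
    · change g (ψ b) = _
      simp [hψ, hg, hhτ]
    · change ψ (g x) = _
      rcases subsingleton_or_nontrivial (A ⊗[R] S) with _ | _
      · exact Subsingleton.elim _ _
      have : Fact p.Prime := ⟨hp⟩
      have : CharP (A ⊗[R] S) p := (CharP.charP_iff_prime_eq_zero hp).mpr hpT
      induction x with
      | zero => simp [hp.ne_zero]
      | add x y hx hy => rw [map_add, map_add, hx, hy, add_pow_char]
      | tmul a s =>
        rw [hg, hψ, map_mul, hτ, hτh, Algebra.TensorProduct.tmul_pow, ← hσA, ← Algebra.smul_def,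
          ← TensorProduct.smul_tmul, Algebra.smul_def, mul_one]
  let e := AlgEquiv.ofBijective g hbij
  have he (a : A) (s : S) : e (a ⊗ₜ s) = algebraMap A B a * h s := rfl
  refine ⟨k.toRingHom.comp e.symm, ⟨?_, ?_⟩, fun w ⟨hwh, hwA⟩ ↦ ?_⟩
  · ext s
    have : h s = e (1 ⊗ₜ s) := by simp [he]
    simp [this, hk]
  · ext a
    have : algebraMap A B a = e (a ⊗ₜ 1) := by simp [he]
    simp only [this, RingHom.comp_apply]
    simp [hk]
  · ext b
    obtain ⟨x, rfl⟩ := e.surjective b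
    induction x with
    | zero => simp
    | add x y hx hy => rw [map_add, map_add, map_add, hx, hy]
    | tmul a s =>
      have hw : w (e (a ⊗ₜ s)) = v a * f s := by rw [he, map_mul, ← hwh, ← hwA]; rfl
      simp [hw, hk]

/-- Let `p` be a prime, `A` a commutative ring with `p·1 = 0` and `A → B` an étale ring
homomorphism. Then the square formed by the Frobenius endomorphisms `φ_A`, `φ_B` and the
structure map `f : A → B` is cocartesian in commutative rings: for every commutative
ring `C` and homomorphisms `u : B → C`, `v : A → C` with `u ∘ f = v ∘ φ_A`, there is a
unique `w : B → C` with `w ∘ φ_B = u` and `w ∘ f = v`. (Equivalently, the ring map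
`B ⊗_{A, φ_A} A → B`, `b ⊗ a ↦ b^p · f(a)`, is an isomorphism.) -/
theorem frobenius_square_cocartesian (p : ℕ) (hp : p.Prime) (A B : Type u)
    [CommRing A] [CommRing B] [Algebra A B] [Algebra.Etale A B] (hA : (p : A) = 0)
    (φA : A →+* A) (φB : B →+* B) (hφA : ∀ x, φA x = x ^ p) (hφB : ∀ x, φB x = x ^ p) :
    ∀ (C : Type u) [CommRing C] (u : B →+* C) (v : A →+* C),
      u.comp (algebraMap A B) = v.comp φA →
      ∃! w : B →+* C, w.comp φB = u ∧ w.comp (algebraMap A B) = v := by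
  intro C _ u v huv
  exact @Algebra.Etale.existsUnique_ringHom_of_pow p hp A A B B C _ _ _ _ _ _ _ _ _ φA.toAlgebra
    hA φB (.id A) (.id B)
    (fun r ↦ (hφB _).trans ((map_pow _ r p).symm.trans (congrArg _ (hφA r).symm)))
    (fun _ ↦ rfl) hφA hφB hφB u v (RingHom.congr_fun huv)
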